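/- For every position G, c(G) ≤ v(G). -/

import Mathlib

namespace DotsAndBoxes

/-- A component of a Dots & Boxes endgame position: an `n`-chain or an `n`-loop. -/
inductive Component : Type where
  | chain (n : ℕ)
  | loop (n : ℕ)
deriving DecidableEq

namespace Component

/-- The number of boxes in a component. -/
def size : Component → ℕ
  | chain n => n
  | loop n => n

def isChain : Component → Bool
  | chain _ => true
  | loop _ => false

def isLoop : Component → Bool
  | chain _ => false
  | loop _ => true

/-- A chain must have length at least 3; a loop must have even length at least 4. -/
def Valid : Component → Prop
  | chain n => 3 ≤ n
  | loop n => 4 ≤ n ∧ Even n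

end Component

/-- A position is a finite multiset of components. -/
abbrev Position := Multiset Component

def Position.Valid (G : Position) : Prop := ∀ C ∈ G, C.Valid

/-- The number of unclaimed boxes in a position. -/
def size (G : Position) : ℕ := (G.map Component.size).sum

/-- The number of chains of a position. -/
def numChains (G : Position) : ℕ := Multiset.card (G.filter fun C => C.isChain = true)

/-- The number of loops of a position. -/
def numLoops (G : Position) : ℕ := Multiset.card (G.filter fun C => C.isLoop = true)

/-- θ(G), the number of 3-chains. -/
def theta (G : Position) : ℕ := G.count (Component.chain 3)

/-- f(G), the number of 4-loops. -/
def numF (G : Position) : ℕ := G.count (Component.loop 4)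

/-- s(G), the number of 6-loops. -/
def numS (G : Position) : ℕ := G.count (Component.loop 6)

open Classical in
/-- The terminal bonus tb(G). -/
noncomputable def tb (G : Position) : ℤ :=
  if G = 0 then 0
  else if ∀ C ∈ G, C.isLoop = true then 8
  else if (∃ C ∈ G, C.isLoop = true) ∧ Component.chain 3 ∈ G ∧
      (∀ C ∈ G, C.isChain = true → C = Component.chain 3) then 6
  else 4

/-- The controlled value c(G). -/
noncomputable def cval (G : Position) : ℤ :=
  (size G : ℤ) - 4 * (numChains G : ℤ) - 8 * (numLoops G : ℤ) + tb G

/-- The score v(G;C) of opening component `C`, given that the remainder of the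
position has value `w`. -/
def openVal (C : Component) (w : ℤ) : ℤ :=
  match C with
  | Component.chain n => ((n : ℤ) - 2) + |w - 2|
  | Component.loop n => ((n : ℤ) - 4) + |w - 4|

/-- Auxiliary recursion (on the number of components) for the value `v`. -/
noncomputable def valueAux : ℕ → Position → ℤ
  | 0, _ => 0
  | n + 1, G =>
    if G = 0 then 0
    else sInf { x : ℤ | ∃ C ∈ G, x = openVal C (valueAux n (G.erase C)) }

/-- The value v(G): v(∅) = 0, and v(G) = min over components C of G of v(G;C). -/
noncomputable def value (G : Position) : ℤ := valueAux (Multiset.card G) G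

/-- v(G;C), the value of G given that the opener has just opened C. -/
noncomputable def valueOpen (G : Position) (C : Component) : ℤ :=
  openVal C (value (G.erase C))

/-- Opening a component C of G is optimal if C ∈ G and v(G;C) = v(G). -/
def Optimal (G : Position) (C : Component) : Prop :=
  C ∈ G ∧ valueOpen G C = value G


lemma cval_zero : cval 0 = 0 := by
  simp [cval, size, numChains, numLoops, tb]

lemma cval_chain (n : ℕ) (H : Position) :
    cval (Component.chain n ::ₘ H) =
      cval H + n - 4 + (tb (Component.chain n ::ₘ H) - tb H) := by
  have h1 : numChains (Component.chain n ::ₘ H) = numChains H + 1 := by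
    unfold numChains
    rw [Multiset.filter_cons_of_pos _ (by simp [Component.isChain])]; simp
  have h2 : numLoops (Component.chain n ::ₘ H) = numLoops H := by
    unfold numLoops
    rw [Multiset.filter_cons_of_neg _ (by simp [Component.isLoop])]
  have h3 : size (Component.chain n ::ₘ H) = n + size H := by
    simp [size, Component.size]
  rw [cval, cval, h1, h2, h3]
  push_cast
  ring

lemma cval_loop (n : ℕ) (H : Position) :
    cval (Component.loop n ::ₘ H) =
      cval H + n - 8 + (tb (Component.loop n ::ₘ H) - tb H) := by
  have h1 : numChains (Component.loop n ::ₘ H) = numChains H := by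
    unfold numChains
    rw [Multiset.filter_cons_of_neg _ (by simp [Component.isChain])]
  have h2 : numLoops (Component.loop n ::ₘ H) = numLoops H + 1 := by
    unfold numLoops
    rw [Multiset.filter_cons_of_pos _ (by simp [Component.isLoop])]; simp
  have h3 : size (Component.loop n ::ₘ H) = n + size H := by
    simp [size, Component.size]
  rw [cval, cval, h1, h2, h3]
  push_cast
  ring

lemma tb_zero : tb 0 = 0 := by simp [tb]

lemma tb_chain_le (n : ℕ) (H : Position) (h : H ≠ 0) :
    tb (Component.chain n ::ₘ H) ≤ tb H := by
  have h0 : Component.chain n ::ₘ H ≠ 0 := Multiset.cons_ne_zero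
  have h1 : ¬ ∀ C ∈ Component.chain n ::ₘ H, C.isLoop = true := by
    intro hh
    have := hh _ (Multiset.mem_cons_self _ _)
    simp [Component.isLoop] at this
  unfold tb
  rw [if_neg h0, if_neg h1, if_neg h]
  by_cases h2 : ∀ C ∈ H, C.isLoop = true
  · rw [if_pos h2]; split_ifs <;> norm_num
  · rw [if_neg h2]
    by_cases h3 : (∃ C ∈ Component.chain n ::ₘ H, C.isLoop = true) ∧
      Component.chain 3 ∈ Component.chain n ::ₘ H ∧
      (∀ C ∈ Component.chain n ::ₘ H, C.isChain = true → C = Component.chain 3)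
    · rw [if_pos h3]
      obtain ⟨⟨C, hC, hl⟩, -, hall⟩ := h3
      have hC' : C ∈ H := by
        rcases Multiset.mem_cons.1 hC with rfl | hC
        · simp [Component.isLoop] at hl
        · exact hC
      have hall' : ∀ C ∈ H, C.isChain = true → C = Component.chain 3 :=
        fun D hD => hall D (Multiset.mem_cons_of_mem hD)
      push Not at h2
      obtain ⟨D, hD, hDl⟩ := h2
      have hDc : D.isChain = true := by cases D <;> simp_all [Component.isLoop, Component.isChain]
      have := hall' D hD hDc
      subst this
      rw [if_pos ⟨⟨C, hC', hl⟩, hD, hall'⟩]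
    · rw [if_neg h3]; split_ifs <;> norm_num

lemma tb_loop (n : ℕ) (H : Position) (h : H ≠ 0) :
    tb (Component.loop n ::ₘ H) ≤ tb H ∨
      (tb (Component.loop n ::ₘ H) = 6 ∧ tb H = 4 ∧ ∀ C ∈ H, C = Component.chain 3) := by
  have h0 : Component.loop n ::ₘ H ≠ 0 := Multiset.cons_ne_zero
  by_cases h2 : ∀ C ∈ H, C.isLoop = true
  · left
    unfold tb
    rw [if_neg h0, if_neg h, if_pos h2]
    split_ifs <;> norm_num
  have h1 : ¬ ∀ C ∈ Component.loop n ::ₘ H, C.isLoop = true :=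
    fun hh => h2 fun C hC => hh C (Multiset.mem_cons_of_mem hC)
  unfold tb
  rw [if_neg h0, if_neg h, if_neg h1, if_neg h2]
  by_cases h3 : (∃ C ∈ Component.loop n ::ₘ H, C.isLoop = true) ∧
      Component.chain 3 ∈ Component.loop n ::ₘ H ∧
      (∀ C ∈ Component.loop n ::ₘ H, C.isChain = true → C = Component.chain 3)
  · rw [if_pos h3]
    by_cases h4 : (∃ C ∈ H, C.isLoop = true) ∧ Component.chain 3 ∈ H ∧
      (∀ C ∈ H, C.isChain = true → C = Component.chain 3)
    · rw [if_pos h4]; left; norm_num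
    · rw [if_neg h4]; right
      refine ⟨rfl, rfl, ?_⟩
      obtain ⟨-, hm, hall⟩ := h3
      have hm' : Component.chain 3 ∈ H := by simpa using hm
      have hall' : ∀ C ∈ H, C.isChain = true → C = Component.chain 3 :=
        fun D hD => hall D (Multiset.mem_cons_of_mem hD)
      intro C hC
      cases C with
      | chain m => exact hall' _ hC rfl
      | loop m => exact absurd ⟨⟨_, hC, rfl⟩, hm', hall'⟩ h4
  · rw [if_neg h3]; left; split_ifs <;> norm_num

lemma valueAux_chain_three : valueAux 1 {Component.chain 3} = 3 := by
  have : {x : ℤ | ∃ C ∈ ({Component.chain 3} : Position),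
      x = openVal C (valueAux 0 (Multiset.erase {Component.chain 3} C))} = {3} := by
    ext x
    simp [openVal, valueAux]
  rw [valueAux, if_neg (by simp), this, csInf_singleton]

lemma cval_replicate (k : ℕ) (hk : tb (Multiset.replicate k (Component.chain 3)) = 4) :
    cval (Multiset.replicate k (Component.chain 3)) = 4 - k := by
  have h1 : numChains (Multiset.replicate k (Component.chain 3)) = k := by
    unfold numChains
    rw [Multiset.filter_eq_self.2, Multiset.card_replicate]
    intro C hC
    rw [Multiset.eq_of_mem_replicate hC]; rfl
  have h2 : numLoops (Multiset.replicate k (Component.chain 3)) = 0 := by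
    unfold numLoops
    rw [Multiset.filter_eq_nil.2, Multiset.card_zero]
    intro C hC
    rw [Multiset.eq_of_mem_replicate hC]; simp [Component.isLoop]
  have h3 : size (Multiset.replicate k (Component.chain 3)) = k * 3 := by
    simp [size, Component.size]
  rw [cval, h1, h2, h3, hk]
  push_cast
  ring

lemma cval_le_valueAux (n : ℕ) : ∀ G : Position, Multiset.card G = n → cval G ≤ valueAux n G := by
  induction n with
  | zero =>
    intro G hG
    rw [Multiset.card_eq_zero.1 hG, cval_zero, valueAux]
  | succ n ih =>
    intro G hG
    have hG0 : G ≠ 0 := by rintro rfl; simp at hG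
    rw [valueAux, if_neg hG0]
    apply le_csInf
    · obtain ⟨C, hC⟩ := Multiset.exists_mem_of_ne_zero hG0
      exact ⟨_, C, hC, rfl⟩
    rintro x ⟨C, hC, rfl⟩
    obtain ⟨H, rfl⟩ := Multiset.exists_cons_of_mem hC
    have hH : Multiset.card H = n := by simpa using hG
    rw [Multiset.erase_cons_head]
    have hw := ih H hH
    by_cases h0 : H = 0
    · subst h0
      have hn : n = 0 := by simpa using hH.symm
      subst hn
      cases C with
      | chain m =>
        rw [cval_chain, cval_zero, tb_zero]
        have : tb (Component.chain m ::ₘ 0) = 4 := by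
          simp [tb, Component.isLoop]
        simp only [this, openVal, valueAux]
        norm_num
      | loop m =>
        rw [cval_loop, cval_zero, tb_zero]
        have : tb (Component.loop m ::ₘ 0) = 8 := by
          simp [tb, Component.isLoop]
        simp only [this, openVal, valueAux]
        norm_num
    · cases C with
      | chain m =>
        have ht := tb_chain_le m H h0
        rw [cval_chain]
        simp only [openVal]
        have := le_abs_self (valueAux n H - 2)
        linarith
      | loop m =>
        rw [cval_loop]
        simp only [openVal]
        rcases tb_loop m H h0 with ht | ⟨h6, h4, hall⟩
        · have := le_abs_self (valueAux n H - 4)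
          linarith
        · have hr := Multiset.eq_replicate.2 ⟨hH, hall⟩
          have hc : cval H = 4 - n := by
            rw [hr] at h4 ⊢
            exact cval_replicate n h4
          rw [h6, h4, hc]
          have hn : n ≠ 0 := by rintro rfl; exact h0 (Multiset.card_eq_zero.1 hH)
          by_cases h1 : n = 1
          · subst h1
            rw [Multiset.replicate_one] at hr
            rw [hr, valueAux_chain_three]
            norm_num
            linarith
          · have h2 : (2 : ℤ) ≤ n := by omega
            have := abs_nonneg (valueAux n H - 4)
            linarith

/-- For every position G, c(G) ≤ v(G). -/
theorem cval_le_value (G : Position) (hG : G.Valid) : cval G ≤ value G := by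
  exact cval_le_valueAux _ G rfl

end DotsAndBoxes
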